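/- Let α > 1, σ > 0 and ε > 0 be real numbers, let s₁ be a real number with s₁ ≤ (2σ − 2ε)/(α − 1), and let s₂ ∈ ℝ. Define a_n = ⟨n⟩^{−1/2−ε} for n ∈ ℤ, and for N ∈ ℕ set S_N = Σ_{n ∈ ℤ, 0 < |n| ≤ 2N} ⟨n⟩^{−2s₂} | Σ_{m ∈ ℤ, |m| ≤ N, |n+m| ≤ N} ⟨n+m⟩^σ ⟨m⟩^σ ⟨ |n+m|^α − |m|^α ⟩^{−s₁} a_{n+m} a_m |². Then S_N → +∞ as N → ∞. -/

import Mathlib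

open Real Filter Finset

noncomputable section

/-- The Japanese bracket `⟨x⟩ = (1 + x²)^{1/2}`. -/
def jb (x : ℝ) : ℝ := (1 + x ^ 2) ^ ((1:ℝ)/2)

lemma jb_ge (x : ℝ) : x ≤ jb x := by
  unfold jb
  rw [← Real.sqrt_eq_rpow]
  apply Real.le_sqrt_of_sq_le
  linarith

lemma jb_le (x : ℝ) (hx : 0 ≤ x) : jb x ≤ 1 + x := by
  unfold jb
  rw [← Real.sqrt_eq_rpow]
  apply Real.sqrt_le_iff.2
  constructor
  · linarith
  · nlinarith

lemma jb_pos (x : ℝ) : 0 < jb x := by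
  unfold jb
  positivity

lemma rpow_comp (b p : ℝ) (hb : 0 < b) :
    ∃ c : ℝ, 0 < c ∧ ∀ x y : ℝ, 0 < x → x ≤ y → y ≤ b * x → c * x ^ p ≤ y ^ p := by
  refine ⟨min 1 (b ^ p), lt_min one_pos (by positivity), fun x y hx h1 h2 => ?_⟩
  have hxp : 0 < x ^ p := by positivity
  rcases le_total 0 p with hp | hp
  · calc min 1 (b ^ p) * x ^ p ≤ 1 * x ^ p := by gcongr; exact min_le_left _ _
      _ ≤ y ^ p := by rw [one_mul]; exact Real.rpow_le_rpow hx.le h1 hp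
  · calc min 1 (b ^ p) * x ^ p ≤ b ^ p * x ^ p := by gcongr; exact min_le_right _ _
      _ = (b * x) ^ p := (Real.mul_rpow hb.le hx.le).symm
      _ ≤ y ^ p := Real.rpow_le_rpow_of_nonpos (lt_of_lt_of_le hx h1) h2 hp

lemma diff_lower (α x : ℝ) (hα : 1 < α) (hx : 1 ≤ x) :
    x ^ (α - 1) ≤ (x + 1) ^ α - x ^ α := by
  have e1 : (x + 1) ^ α = (x + 1) ^ (α - 1) * (x + 1) := by
    rw [← Real.rpow_add_one (by linarith)]; congr 1; ring
  have e2 : x ^ α = x ^ (α - 1) * x := by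
    rw [← Real.rpow_add_one (by linarith)]; congr 1; ring
  have h : x ^ (α - 1) ≤ (x + 1) ^ (α - 1) :=
    Real.rpow_le_rpow (by linarith) (by linarith) (by linarith)
  rw [e1, e2]
  nlinarith

lemma diff_upper (α x : ℝ) (hα : 1 < α) (hx : 1 ≤ x) :
    (x + 1) ^ α - x ^ α ≤ α * 2 ^ (α - 1) * x ^ (α - 1) := by
  have e1 : (x + 1) ^ α = (x + 1) ^ (α - 1) * (x + 1) := by
    rw [← Real.rpow_add_one (by linarith)]; congr 1; ring
  have hx1 : 0 < x + 1 := by linarith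
  have hb := one_add_mul_self_le_rpow_one_add (s := -(1 / (x + 1))) (p := α)
    (by rw [neg_le_neg_iff, div_le_one hx1]; linarith) hα.le
  have e3 : x ^ α = (x + 1) ^ α * (1 + -(1 / (x + 1))) ^ α := by
    have h0 : 1 + -(1 / (x + 1)) = x / (x + 1) := by field_simp; ring
    rw [h0, ← Real.mul_rpow hx1.le (by positivity)]
    congr 1; field_simp
  have h4 : (x + 1) ^ α * (1 + α * -(1 / (x + 1))) ≤ x ^ α := by
    rw [e3]; gcongr
  have h5 : (x + 1) ^ α * (1 + α * -(1 / (x + 1))) = (x + 1) ^ α - α * (x + 1) ^ (α - 1) := by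
    rw [e1]; field_simp; ring
  have h6 : (x + 1) ^ (α - 1) ≤ 2 ^ (α - 1) * x ^ (α - 1) := by
    rw [← Real.mul_rpow (by norm_num) (by linarith)]
    exact Real.rpow_le_rpow hx1.le (by linarith) (by linarith)
  nlinarith

lemma term_lower (α σ ε s₁ : ℝ) (hα : 1 < α)
    (hs₁ : s₁ ≤ (2 * σ - 2 * ε) / (α - 1)) :
    ∃ c : ℝ, 0 < c ∧ ∀ x : ℝ, 1 ≤ x →
      c * (1 / x) ≤ jb (1 + x) ^ σ * jb x ^ σ
                * jb (|1 + x| ^ α - |x| ^ α) ^ (-s₁)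
                * (jb (1 + x) ^ (-(1/2 : ℝ) - ε))
                * (jb x ^ (-(1/2 : ℝ) - ε)) := by
  obtain ⟨c1, hc1, h1⟩ := rpow_comp 3 σ (by norm_num)
  obtain ⟨c2, hc2, h2⟩ := rpow_comp (1 + α * 2 ^ (α - 1)) (-s₁) (by positivity)
  obtain ⟨c3, hc3, h3⟩ := rpow_comp 3 (-(1/2 : ℝ) - ε) (by norm_num)
  refine ⟨c1 * c1 * c2 * c3 * c3, by positivity, fun x hx => ?_⟩
  have hx0 : 0 < x := by linarith
  have a1 : x ≤ jb (1 + x) := le_trans (by linarith) (jb_ge _)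
  have a2 : jb (1 + x) ≤ 3 * x := (jb_le _ (by linarith)).trans (by linarith)
  have b1 : x ≤ jb x := jb_ge _
  have b2 : jb x ≤ 3 * x := (jb_le _ (by linarith)).trans (by linarith)
  have hd1 := diff_lower α x hα hx
  have hd2 := diff_upper α x hα hx
  have hxp : 1 ≤ x ^ (α - 1) := Real.one_le_rpow hx (by linarith)
  rw [abs_of_pos hx0, abs_of_pos (by linarith : 0 < 1 + x), add_comm 1 x]
  rw [add_comm 1 x] at a1 a2
  have g1 : x ^ (α - 1) ≤ jb ((x + 1) ^ α - x ^ α) := hd1.trans (jb_ge _)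
  have g2 : jb ((x + 1) ^ α - x ^ α) ≤ (1 + α * 2 ^ (α - 1)) * x ^ (α - 1) :=
    (jb_le _ (by linarith)).trans (by linarith)
  have k1 := h1 _ _ hx0 a1 a2
  have k2 := h1 _ _ hx0 b1 b2
  have k3 := h2 _ _ (by positivity) g1 g2
  have k4 := h3 _ _ hx0 a1 a2
  have k5 := h3 _ _ hx0 b1 b2
  have p1 := jb_pos (x + 1)
  have p2 := jb_pos x
  have p3 := jb_pos ((x + 1) ^ α - x ^ α)
  have key : 1 / x ≤ x ^ σ * x ^ σ * (x ^ (α - 1)) ^ (-s₁) * x ^ (-(1/2 : ℝ) - ε)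
      * x ^ (-(1/2 : ℝ) - ε) := by
    rw [← Real.rpow_mul hx0.le, ← Real.rpow_add hx0, ← Real.rpow_add hx0, ← Real.rpow_add hx0,
      ← Real.rpow_add hx0, one_div, ← Real.rpow_neg_one]
    apply Real.rpow_le_rpow_of_exponent_le hx
    rw [le_div_iff₀ (by linarith)] at hs₁
    nlinarith
  calc c1 * c1 * c2 * c3 * c3 * (1 / x)
      ≤ c1 * c1 * c2 * c3 * c3 * (x ^ σ * x ^ σ * (x ^ (α - 1)) ^ (-s₁) * x ^ (-(1/2 : ℝ) - ε)
      * x ^ (-(1/2 : ℝ) - ε)) := by gcongr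
    _ = (c1 * x ^ σ) * (c1 * x ^ σ) * (c2 * (x ^ (α - 1)) ^ (-s₁)) * (c3 * x ^ (-(1/2 : ℝ) - ε))
      * (c3 * x ^ (-(1/2 : ℝ) - ε)) := by ring
    _ ≤ _ := by gcongr

/-- Optimality of the time-regularity exponent `s₁ = 2σ/(α−1)`: for the datum
with Fourier coefficients `a_n = ⟨n⟩^{−1/2−ε}` and any `s₁ ≤ (2σ−2ε)/(α−1)`,
the quantity `S_N = ‖⟨D_t⟩^{−s₁} f_N(0,·)‖²_{H^{−s₂}}` diverges. -/
theorem optimality_time_regularity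
    (α σ ε s₁ s₂ : ℝ) (hα : 1 < α) (hσ : 0 < σ) (hε : 0 < ε)
    (hs₁ : s₁ ≤ (2 * σ - 2 * ε) / (α - 1)) :
    Tendsto
      (fun N : ℕ =>
        ∑ n ∈ (Finset.Icc (-(2 * (N : ℤ))) (2 * (N : ℤ))).filter
            (fun n => n ≠ 0),
          jb (n : ℝ) ^ (-(2 * s₂)) *
            (∑ m ∈ (Finset.Icc (-(N : ℤ)) (N : ℤ)).filter
                (fun m => |n + m| ≤ (N : ℤ)),
              jb ((n + m : ℤ) : ℝ) ^ σ * jb ((m : ℤ) : ℝ) ^ σ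
                * jb (|((n + m : ℤ) : ℝ)| ^ α - |((m : ℤ) : ℝ)| ^ α) ^ (-s₁)
                * (jb ((n + m : ℤ) : ℝ) ^ (-(1/2 : ℝ) - ε))
                * (jb ((m : ℤ) : ℝ) ^ (-(1/2 : ℝ) - ε))) ^ 2)
      atTop atTop := by
  obtain ⟨c, hc, hterm⟩ := term_lower α σ ε s₁ hα hs₁
  have hH : Tendsto (fun N : ℕ => jb 1 ^ (-(2 * s₂)) *
      (c * ∑ i ∈ Finset.range (N - 1), (1 / ((i : ℝ) + 1))) ^ 2) atTop atTop := by
    apply Tendsto.const_mul_atTop (Real.rpow_pos_of_pos (jb_pos 1) _)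
    refine (tendsto_pow_atTop two_ne_zero).comp ?_
    apply Tendsto.const_mul_atTop hc
    exact tendsto_sum_range_one_div_nat_succ_atTop.comp (tendsto_sub_atTop_nat 1)
  refine tendsto_atTop_mono' _ ?_ hH
  filter_upwards [eventually_ge_atTop 1] with N hN
  have hnn : ∀ x p : ℝ, 0 ≤ jb x ^ p := fun x p => (Real.rpow_pos_of_pos (jb_pos x) p).le
  refine le_trans ?_ (Finset.single_le_sum (a := (1 : ℤ)) ?_ ?_)
  · rw [Int.cast_one]
    refine mul_le_mul_of_nonneg_left ?_ (hnn _ _)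
    refine pow_le_pow_left₀ (mul_nonneg hc.le (Finset.sum_nonneg fun i _ => by positivity)) ?_ 2
    rw [Finset.mul_sum]
    have hinj : Set.InjOn (fun i : ℕ => (i : ℤ) + 1) (Finset.range (N - 1)) := by
      intro a _ b _ h
      simpa using h
    refine le_trans ?_ (Finset.sum_le_sum_of_subset_of_nonneg
      (s := (Finset.range (N - 1)).image (fun i : ℕ => (i : ℤ) + 1)) ?_ ?_)
    · rw [Finset.sum_image hinj]
      refine Finset.sum_le_sum fun i _ => ?_
      have := hterm ((i : ℝ) + 1) (by linarith [Nat.cast_nonneg (α := ℝ) i])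
      push_cast
      exact this
    · intro m hm
      simp only [Finset.mem_image, Finset.mem_range] at hm
      obtain ⟨i, hi, rfl⟩ := hm
      simp only [Finset.mem_filter, Finset.mem_Icc, abs_le]
      omega
    · intro m _ _
      have := hnn
      exact mul_nonneg (mul_nonneg (mul_nonneg (mul_nonneg (hnn _ _) (hnn _ _)) (hnn _ _))
        (hnn _ _)) (hnn _ _)
  · intro n _
    exact mul_nonneg (hnn _ _) (sq_nonneg _)
  · simp only [Finset.mem_filter, Finset.mem_Icc]
    omega
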